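/- arXiv:2107.00503 — 5 statements merged into one kernel-verified Lean document; each statement's English description precedes it below -/
import Mathlib

section
/- The maximal orders in K^{d×d} are exactly the endomorphism rings of lattices: for every lattice L in K^d, End_{O_K}(L) is a maximal order in K^{d×d}, and conversely every maximal order in K^{d×d} equals End_{O_K}(L) for some lattice L in K^d. -/
set_option synthInstance.maxHeartbeats 400000
set_option maxHeartbeats 1600000

open scoped Pointwise

/-- The valuation ring `O_K` of a (surjective discrete) additive valuation on `K`. -/
def valRing {K : Type*} [Field K] (v : AddValuation K (WithTop ℤ)) : Subring K where
  carrier := {x | 0 ≤ v x}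
  zero_mem' := by simp only [Set.mem_setOf_eq, v.map_zero]; exact le_top
  one_mem' := by simp only [Set.mem_setOf_eq, v.map_one, le_refl]
  add_mem' := fun {a b} ha hb => v.map_le_add ha hb
  mul_mem' := fun {a b} ha hb => by
    simp only [Set.mem_setOf_eq, v.map_mul] at *
    exact add_nonneg ha hb
  neg_mem' := fun {a} ha => by simpa only [Set.mem_setOf_eq, v.map_neg] using ha

/-- `End_{O_K}(L) = {X ∈ K^{d×d} : X L ⊆ L}` as a set of matrices. -/
def endSet {K : Type*} [Field K] {d : ℕ} (L : Set (Fin d → K)) :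
    Set (Matrix (Fin d) (Fin d) K) :=
  {X | ∀ x ∈ L, X.mulVec x ∈ L}

/-- A lattice in `K^d`: a free `O_K`-submodule of rank `d`. -/
def isLattice {K : Type*} [Field K] (v : AddValuation K (WithTop ℤ)) {d : ℕ}
    (L : Submodule (valRing v) (Fin d → K)) : Prop :=
  Module.Free (valRing v) L ∧ Module.rank (valRing v) L = (d : Cardinal)

/-- An order in `K^{d×d}`: a unital subring that is an `O_K`-submodule
(i.e. an `O_K`-subalgebra) which is free of rank `d²` as an `O_K`-module. -/
def isOrder {K : Type*} [Field K] (v : AddValuation K (WithTop ℤ)) {d : ℕ}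
    (Λ : Subalgebra (valRing v) (Matrix (Fin d) (Fin d) K)) : Prop :=
  Module.Free (valRing v) Λ ∧ Module.rank (valRing v) Λ = ((d * d : ℕ) : Cardinal)

section PrincipalIdealRing

variable {R K n : Type*} [CommRing R] [IsDomain R] [Field K] [Algebra R K] [IsFractionRing R K]

open Module

/-- The endomorphism ring of a submodule `L` of `K^n`, as a subalgebra of the matrix ring. -/
def endSubalgebra [Fintype n] [DecidableEq n] (L : Submodule R (n → K)) :
    Subalgebra R (Matrix n n K) where
  carrier := {X | ∀ x ∈ L, X.mulVec x ∈ L}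
  mul_mem' := fun {X Y} hX hY x hx => by
    rw [← Matrix.mulVec_mulVec]
    exact hX _ (hY _ hx)
  add_mem' := fun {X Y} hX hY x hx => by
    rw [Matrix.add_mulVec]
    exact L.add_mem (hX x hx) (hY x hx)
  algebraMap_mem' := fun r x hx => by
    rw [Algebra.algebraMap_eq_smul_one, Matrix.smul_mulVec, Matrix.one_mulVec]
    exact L.smul_mem r hx

/-- A finite free submodule of full rank contains a basis of the ambient space, and its elements
are the vectors with integral coordinates. -/
theorem Submodule.IsLattice.exists_basis_mem_iff [IsPrincipalIdealRing R] {V : Type*}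
    [AddCommGroup V] [Module K V] [Module R V] [IsScalarTower R K V]
    (L : Submodule R V) [L.IsLattice K] :
    ∃ (ι : Type) (_ : Fintype ι) (b : Basis ι K V),
      ∀ x, x ∈ L ↔ ∀ i, b.repr x i ∈ (algebraMap R K).range := by
  have : Module.IsTorsionFree R V := Module.IsTorsionFree.trans_faithfulSMul R K V
  let b := Module.finBasis R L
  refine ⟨Fin (finrank R L), inferInstance, b.extendOfIsLattice K, fun x => ?_⟩
  have hL : L = Submodule.span R (Set.range (b.extendOfIsLattice K)) := by
    have h : ⇑(b.extendOfIsLattice K) = L.subtype ∘ b := by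
      ext1 i
      simp
    rw [h, Set.range_comp, ← Submodule.map_span, b.span_eq, Submodule.map_top,
      Submodule.range_subtype]
  conv_lhs => rw [hL]
  rw [Basis.mem_span_iff_repr_mem]
  rfl

theorem isLattice_endSubalgebra [IsPrincipalIdealRing R] [Fintype n] [DecidableEq n]
    (L : Submodule R (n → K)) [L.IsLattice K] :
    (Subalgebra.toSubmodule (endSubalgebra L)).IsLattice K := by
  obtain ⟨ι, _, b, hb⟩ := Submodule.IsLattice.exists_basis_mem_iff L
  have hbL : ∀ i, b i ∈ L := fun i => by
    classical
    rw [hb]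
    intro j
    rw [b.repr_self, Finsupp.single_apply]
    split_ifs
    · exact one_mem _
    · exact zero_mem _
  constructor
  · rw [← Module.Finite.iff_fg]
    let f : Subalgebra.toSubmodule (endSubalgebra L) →ₗ[R] (ι → L) :=
      { toFun := fun X i => ⟨X.1.mulVec (b i), X.2 _ (hbL i)⟩
        map_add' := fun X Y => by
          ext1 i
          exact Subtype.ext (Matrix.add_mulVec _ _ _)
        map_smul' := fun r X => by
          ext1 i
          exact Subtype.ext (Matrix.smul_mulVec _ _ _) }
    have hf : Function.Injective f := fun X Y h => by
      refine Subtype.ext (Matrix.toLin'.injective (b.ext fun i => ?_))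
      exact congrArg Subtype.val (congrFun h i)
    exact Module.Finite.of_injective f hf
  · rw [eq_top_iff]
    rintro X -
    obtain ⟨c, hc⟩ := IsLocalization.exist_integer_multiples_of_finite (nonZeroDivisors R)
      (fun ij : ι × ι => b.repr (X.mulVec (b ij.1)) ij.2)
    have hcX : (c : R) • X ∈ endSubalgebra L := by
      intro x hx
      rw [hb] at hx ⊢
      intro i
      have hX : ((c : R) • X).mulVec x =
          ∑ j, b.repr x j • (c : R) • X.mulVec (b j) := by
        conv_lhs => rw [← b.sum_repr x]
        rw [Matrix.mulVec_sum]
        simp only [Matrix.mulVec_smul, Matrix.smul_mulVec]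
      rw [hX, map_sum, Finsupp.finsetSum_apply]
      refine sum_mem fun j _ => ?_
      rw [map_smul, Finsupp.smul_apply, smul_eq_mul]
      refine mul_mem (hx j) ?_
      have := hc (j, i)
      rw [← algebraMap_smul K (c : R) (X.mulVec (b j)), map_smul, Finsupp.smul_apply,
        algebraMap_smul]
      exact this
    have hc0 : algebraMap R K c ≠ 0 :=
      IsFractionRing.to_map_ne_zero_of_mem_nonZeroDivisors c.2
    have hX : X = (algebraMap R K c)⁻¹ • (c : R) • X := by
      rw [← algebraMap_smul K (c : R) X, smul_smul, inv_mul_cancel₀ hc0, one_smul]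
    rw [hX]
    exact Submodule.smul_mem _ _ (Submodule.subset_span hcX)

omit [IsDomain R] in
/-- An eigenvalue of a matrix that is integral over a normal domain lies in that domain. -/
theorem mem_range_algebraMap_of_isIntegral_of_mulVec_eq_smul [IsIntegrallyClosed R] [Fintype n]
    [DecidableEq n] {X : Matrix n n K} (hX : IsIntegral R X) {c : K} {x : n → K} (hx : x ≠ 0)
    (h : X.mulVec x = c • x) : c ∈ (algebraMap R K).range := by
  obtain ⟨P, hP, hPX⟩ := hX
  refine IsIntegrallyClosed.isIntegral_iff.mp ⟨P, hP, ?_⟩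
  have hpow : ∀ k : ℕ, (X ^ k).mulVec x = c ^ k • x := fun k => by
    induction k with
    | zero => simp
    | succ k ih =>
      rw [pow_succ, ← Matrix.mulVec_mulVec, h, Matrix.mulVec_smul, ih, smul_smul, pow_succ']
  have key : (P.eval₂ (algebraMap R (Matrix n n K)) X).mulVec x =
      P.eval₂ (algebraMap R K) c • x := by
    rw [Polynomial.eval₂_eq_sum_range, Polynomial.eval₂_eq_sum_range, Matrix.sum_mulVec,
      Finset.sum_smul]
    refine Finset.sum_congr rfl fun k _ => ?_
    rw [← Algebra.smul_def, ← Algebra.smul_def, Matrix.smul_mulVec, hpow, smul_assoc]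
  rw [hPX, Matrix.zero_mulVec] at key
  exact (smul_eq_zero.mp key.symm).resolve_right hx

/-- The endomorphism ring of a lattice is maximal among subalgebras finite over the base. -/
theorem eq_endSubalgebra_of_le [IsPrincipalIdealRing R] [Fintype n] [DecidableEq n]
    (L : Submodule R (n → K)) [L.IsLattice K] {Λ : Subalgebra R (Matrix n n K)}
    (hfg : (Subalgebra.toSubmodule Λ).FG) (hle : endSubalgebra L ≤ Λ) :
    Λ = endSubalgebra L := by
  classical
  refine le_antisymm (fun X hX => ?_) hle
  obtain ⟨ι, _, b, hb⟩ := Submodule.IsLattice.exists_basis_mem_iff L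
  have hcoef : ∀ i j, b.repr (X.mulVec (b j)) i ∈ (algebraMap R K).range := fun i j => by
    let Y : Matrix n n K := LinearMap.toMatrix' ((b.coord i).smulRight (b j))
    have hYx : ∀ x, Y.mulVec x = b.repr x i • b j := fun x => by
      rw [← Matrix.toLin'_apply]
      simp [Y]
    have hY : Y ∈ endSubalgebra L := fun x hx => by
      rw [hb] at hx ⊢
      intro k
      rw [hYx, map_smul, b.repr_self, Finsupp.smul_apply, Finsupp.single_apply, smul_eq_mul]
      refine mul_mem (hx i) ?_
      split_ifs
      · exact one_mem _
      · exact zero_mem _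
    have hint : IsIntegral R (Y * X) :=
      IsIntegral.of_mem_of_fg Λ hfg _ (Λ.mul_mem (hle hY) hX)
    refine mem_range_algebraMap_of_isIntegral_of_mulVec_eq_smul hint (b.ne_zero j) ?_
    rw [← Matrix.mulVec_mulVec, hYx]
  intro x hx
  rw [hb] at hx ⊢
  intro i
  conv =>
    enter [2]
    rw [← b.sum_repr x]
  rw [Matrix.mulVec_sum, map_sum, Finsupp.finsetSum_apply]
  refine sum_mem fun j _ => ?_
  rw [Matrix.mulVec_smul, map_smul, Finsupp.smul_apply, smul_eq_mul]
  exact mul_mem (hx j) (hcoef i j)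

omit [IsDomain R] [IsFractionRing R K] in
/-- A subalgebra of matrices that is finite over the base stabilizes a lattice. -/
theorem exists_isLattice_le_endSubalgebra [Fintype n] [DecidableEq n]
    {Λ : Subalgebra R (Matrix n n K)} (hfg : (Subalgebra.toSubmodule Λ).FG) :
    ∃ L : Submodule R (n → K), L.IsLattice K ∧ Λ ≤ endSubalgebra L := by
  let f : Matrix n n K →ₗ[R] (n → K) →ₗ[R] (n → K) :=
    LinearMap.mk₂ R (fun X x => X.mulVec x) Matrix.add_mulVec
      (fun r X x => Matrix.smul_mulVec r X x) Matrix.mulVec_add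
      (fun r X x => Matrix.mulVec_smul X r x)
  let L₀ : Submodule R (n → K) := Submodule.span R (Set.range fun i => Pi.single i 1)
  refine ⟨Submodule.map₂ f (Subalgebra.toSubmodule Λ) L₀, ⟨?_, ?_⟩, fun X hX x hx => ?_⟩
  · exact hfg.map₂ f (Submodule.fg_span (Set.finite_range _))
  · rw [eq_top_iff, ← (Pi.basisFun K n).span_eq, Submodule.span_le]
    rintro _ ⟨i, rfl⟩
    refine Submodule.subset_span ?_
    have h := Submodule.apply_mem_map₂ f (m := 1) (n := Pi.single i 1)
      (p := Subalgebra.toSubmodule Λ) (q := L₀) Λ.one_mem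
      (Submodule.subset_span ⟨i, rfl⟩)
    simpa only [f, LinearMap.mk₂_apply, Matrix.one_mulVec, Pi.basisFun_apply, SetLike.mem_coe]
      using h
  · refine (Submodule.map₂_le (q := L₀) (r := (Submodule.map₂ f (Subalgebra.toSubmodule Λ) L₀).comap
      (f X))).mpr (fun Y hY y hy => ?_) hx
    have h := Submodule.apply_mem_map₂ f (p := Subalgebra.toSubmodule Λ) (Λ.mul_mem hX hY) hy
    simpa only [f, Submodule.mem_comap, LinearMap.mk₂_apply, Matrix.mulVec_mulVec] using h

end PrincipalIdealRing

section ValuationRing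

variable {K : Type*} [Field K] (v : AddValuation K (WithTop ℤ))

theorem div_mem_valRing {x y : K} (hy : y ≠ 0) (h : v y ≤ v x) : x / y ∈ valRing v := by
  change 0 ≤ v (x / y)
  have hxy : v x = v (x / y) + v y := by rw [← v.map_mul, div_mul_cancel₀ x hy]
  rw [hxy] at h
  lift v y to ℤ using v.ne_top_iff.mpr hy with m
  cases hz : v (x / y) with
  | top => exact le_top
  | coe k =>
    rw [hz] at h
    norm_cast at h ⊢
    lia

theorem isFractionRing_valRing : IsFractionRing (valRing v) K := by
  refine IsFractionRing.of_field _ _ fun z => ?_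
  by_cases hz : 0 ≤ v z
  · exact ⟨⟨z, hz⟩, 1, by rw [map_one, div_one]; rfl⟩
  · have hz0 : z ≠ 0 := by
      rintro rfl
      simp at hz
    have hmem : 1 / z ∈ valRing v :=
      div_mem_valRing v hz0 (by rw [v.map_one]; exact (not_le.mp hz).le)
    refine ⟨1, ⟨1 / z, hmem⟩, ?_⟩
    rw [map_one]
    exact (one_div_one_div z).symm

theorem isPrincipalIdealRing_valRing : IsPrincipalIdealRing (valRing v) := by
  classical
  refine ⟨fun I => ?_⟩
  by_cases hI : I = ⊥
  · subst hI
    infer_instance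
  have hnat : ∀ a : valRing v, a ≠ 0 → ∃ k : ℕ, v (a : K) = ((k : ℤ) : WithTop ℤ) := fun a ha => by
    have h0 : 0 ≤ v (a : K) := a.2
    have ha' : (a : K) ≠ 0 := fun h => ha (Subtype.ext h)
    lift v (a : K) to ℤ using v.ne_top_iff.mpr ha' with m
    norm_cast at h0
    lift m to ℕ using h0
    exact ⟨m, rfl⟩
  have hex : ∃ k : ℕ, ∃ a ∈ I, a ≠ 0 ∧ v (a : K) = ((k : ℤ) : WithTop ℤ) := by
    obtain ⟨a, haI, ha⟩ := Submodule.exists_mem_ne_zero_of_ne_bot hI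
    obtain ⟨k, hk⟩ := hnat a ha
    exact ⟨k, a, haI, ha, hk⟩
  obtain ⟨a, haI, ha, hav⟩ := Nat.find_spec hex
  have ha' : (a : K) ≠ 0 := fun h => ha (Subtype.ext h)
  refine ⟨a, le_antisymm (fun x hx => ?_) ((Submodule.span_singleton_le_iff_mem a I).mpr haI)⟩
  have hle : v (a : K) ≤ v (x : K) := by
    by_cases hx0 : x = 0
    · subst hx0
      simp
    obtain ⟨k, hk⟩ := hnat x hx0
    rw [hav, hk]
    exact_mod_cast Nat.find_min' hex ⟨x, hx, hx0, hk⟩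
  refine Submodule.mem_span_singleton.mpr ⟨⟨x / a, div_mem_valRing v ha' hle⟩, ?_⟩
  exact Subtype.ext (div_mul_cancel₀ (x : K) ha')

end ValuationRing

section Translation

variable {K : Type*} [Field K] (v : AddValuation K (WithTop ℤ)) {d : ℕ}

theorem isLattice_iff (L : Submodule (valRing v) (Fin d → K)) :
    isLattice v L ↔ L.IsLattice K := by
  have := isFractionRing_valRing v
  have := isPrincipalIdealRing_valRing v
  refine ⟨fun ⟨_, h⟩ => ?_, fun h => ⟨Submodule.IsLattice.free K L, ?_⟩⟩
  · refine Submodule.IsLattice.of_rank_le K ?_ ?_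
    · rw [← Module.Finite.iff_fg, ← Module.rank_lt_aleph0_iff, h]
      exact Cardinal.natCast_lt_aleph0
    · rw [h]; simp
  · rw [Submodule.IsLattice.rank' K L]; simp

theorem isOrder_iff (Λ : Subalgebra (valRing v) (Matrix (Fin d) (Fin d) K)) :
    isOrder v Λ ↔ (Subalgebra.toSubmodule Λ).IsLattice K := by
  have := isFractionRing_valRing v
  have := isPrincipalIdealRing_valRing v
  refine ⟨fun ⟨_, h⟩ => ?_, fun h => ⟨Submodule.IsLattice.free K (Subalgebra.toSubmodule Λ), ?_⟩⟩
  · refine Submodule.IsLattice.of_rank_le K ?_ ?_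
    · rw [← Module.Finite.iff_fg]
      change Module.Finite _ Λ
      rw [← Module.rank_lt_aleph0_iff, h]
      exact Cardinal.natCast_lt_aleph0
    · change _ ≤ Module.rank _ Λ
      rw [h]; simp
  · exact (Submodule.IsLattice.rank' K (Subalgebra.toSubmodule Λ)).trans (by simp)

end Translation

/-- The maximal orders in `K^{d×d}` are exactly the endomorphism rings of
lattices in `K^d`: for every lattice `L`, `End_{O_K}(L)` is a maximal order, and conversely
every maximal order equals `End_{O_K}(L)` for some lattice `L`. -/
theorem maximal_orders_eq_endomorphism_rings {K : Type*} [Field K]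
    (v : AddValuation K (WithTop ℤ)) (hv : Function.Surjective v)
    (d : ℕ) (hd : 0 < d) :
    (∀ L : Submodule (valRing v) (Fin d → K), isLattice v L →
      ∃ E : Subalgebra (valRing v) (Matrix (Fin d) (Fin d) K),
        (E : Set (Matrix (Fin d) (Fin d) K)) = endSet (L : Set (Fin d → K)) ∧
        isOrder v E ∧
        ∀ Λ : Subalgebra (valRing v) (Matrix (Fin d) (Fin d) K),
          isOrder v Λ → E ≤ Λ → Λ = E) ∧
    (∀ Λ : Subalgebra (valRing v) (Matrix (Fin d) (Fin d) K), isOrder v Λ →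
      (∀ Λ' : Subalgebra (valRing v) (Matrix (Fin d) (Fin d) K),
        isOrder v Λ' → Λ ≤ Λ' → Λ' = Λ) →
      ∃ L : Submodule (valRing v) (Fin d → K), isLattice v L ∧
        (Λ : Set (Matrix (Fin d) (Fin d) K)) = endSet (L : Set (Fin d → K))) := by
  have := isFractionRing_valRing v
  have := isPrincipalIdealRing_valRing v
  simp only [isLattice_iff, isOrder_iff]
  refine ⟨fun L hL => ⟨endSubalgebra L, rfl, isLattice_endSubalgebra L,
    fun Λ hΛ hle => eq_endSubalgebra_of_le L hΛ.fg hle⟩, fun Λ hΛ hmax => ?_⟩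
  obtain ⟨L, hL, hle⟩ := exists_isLattice_le_endSubalgebra hΛ.fg
  refine ⟨L, hL, ?_⟩
  rw [← hmax _ (isLattice_endSubalgebra L) hle]
  rfl
end

section
/- Let M = (m_ij) ∈ ℤ^{d×d} have m_ii = 0 for all i. Then Λ_M is an order in K^{d×d} (equivalently, Λ_M is closed under matrix multiplication) if and only if m_ij + m_jk ≥ m_ik for all 1 ≤ i, j, k ≤ d. -/
set_option synthInstance.maxHeartbeats 400000
set_option maxHeartbeats 1600000

open scoped Pointwise

/-- The set `I_N = {X ∈ K^{d×d} : val(X) ≥ N}` (equal to `Λ_N` for suitable `N`). -/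
def matSet {K : Type*} [Field K] (v : AddValuation K (WithTop ℤ)) {d : ℕ}
    (N : Matrix (Fin d) (Fin d) ℤ) : Set (Matrix (Fin d) (Fin d) K) :=
  {X | ∀ i j, (N i j : WithTop ℤ) ≤ v (X i j)}

theorem single_mem_matSet {K : Type*} [Field K] {v : AddValuation K (WithTop ℤ)} {d : ℕ}
    {N : Matrix (Fin d) (Fin d) ℤ} {i j : Fin d} {x : K} (hx : (N i j : WithTop ℤ) ≤ v x) :
    Matrix.single i j x ∈ matSet v N := by
  intro a b
  rw [Matrix.single_apply]
  split_ifs with h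
  · obtain ⟨rfl, rfl⟩ := h
    exact hx
  · rw [v.map_zero]
    exact le_top

theorem mul_mem_matSet {K : Type*} [Field K] {v : AddValuation K (WithTop ℤ)} {d : ℕ}
    {M : Matrix (Fin d) (Fin d) ℤ} (hM : ∀ i j k, M i k ≤ M i j + M j k)
    {X Y : Matrix (Fin d) (Fin d) K} (hX : X ∈ matSet v M) (hY : Y ∈ matSet v M) :
    X * Y ∈ matSet v M := by
  intro i k
  rw [Matrix.mul_apply]
  refine v.map_le_sum fun j _ => ?_
  rw [v.map_mul]
  calc (M i k : WithTop ℤ) ≤ ((M i j + M j k : ℤ) : WithTop ℤ) :=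
        WithTop.coe_le_coe.2 (hM i j k)
    _ = (M i j : WithTop ℤ) + (M j k : WithTop ℤ) := WithTop.coe_add _ _
    _ ≤ v (X i j) + v (Y j k) := add_le_add (hX i j) (hY j k)

theorem triangle_of_mul_mem_matSet {K : Type*} [Field K] {v : AddValuation K (WithTop ℤ)}
    (hv : Function.Surjective v) {d : ℕ} {M : Matrix (Fin d) (Fin d) ℤ}
    (h : ∀ X ∈ matSet v M, ∀ Y ∈ matSet v M, X * Y ∈ matSet v M) (i j k : Fin d) :
    M i k ≤ M i j + M j k := by
  obtain ⟨x, hx⟩ := hv (M i j)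
  obtain ⟨y, hy⟩ := hv (M j k)
  have hxy := h _ (single_mem_matSet hx.ge) _ (single_mem_matSet hy.ge) i k
  rw [Matrix.single_mul_single_same, Matrix.single_apply_same, v.map_mul, hx, hy,
    ← WithTop.coe_add] at hxy
  exact WithTop.coe_le_coe.1 hxy

/-- `Λ_M` as an `O_K`-subalgebra of the matrix ring, when `M` satisfies the triangle
inequalities and has zero diagonal. -/
def matSubalgebra {K : Type*} [Field K] (v : AddValuation K (WithTop ℤ)) {d : ℕ}
    (M : Matrix (Fin d) (Fin d) ℤ) (hdiag : ∀ i, M i i = 0)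
    (hM : ∀ i j k, M i k ≤ M i j + M j k) :
    Subalgebra (valRing v) (Matrix (Fin d) (Fin d) K) where
  carrier := matSet v M
  mul_mem' := mul_mem_matSet hM
  add_mem' hX hY i j := v.map_le_add (hX i j) (hY i j)
  algebraMap_mem' r i j := by
    rw [Matrix.algebraMap_matrix_apply]
    split_ifs with h
    · subst h
      rw [hdiag]
      exact r.2
    · rw [v.map_zero]
      exact le_top

/-- Rescaling each entry by an element of the prescribed valuation identifies `Λ_M` with the
matrices over `O_K`. -/
noncomputable def matrixValRingEquiv {K : Type*} [Field K] {v : AddValuation K (WithTop ℤ)}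
    {d : ℕ} {M : Matrix (Fin d) (Fin d) ℤ}
    (Λ : Subalgebra (valRing v) (Matrix (Fin d) (Fin d) K))
    (hΛ : (Λ : Set (Matrix (Fin d) (Fin d) K)) = matSet v M)
    (c : Matrix (Fin d) (Fin d) K) (hc : ∀ i j, v (c i j) = M i j) :
    Matrix (Fin d) (Fin d) (valRing v) ≃ₗ[valRing v] Λ := by
  have hne (i j) : c i j ≠ 0 :=
    fun h => WithTop.coe_ne_top ((hc i j).symm.trans (v.top_iff.2 h))
  have hmap (A : Matrix (Fin d) (Fin d) (valRing v)) :
      Matrix.of (fun i j => (A i j : K) * c i j) ∈ Λ := by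
    rw [← SetLike.mem_coe, hΛ]
    intro i j
    rw [Matrix.of_apply, v.map_mul, hc]
    exact le_add_of_nonneg_left (A i j).2
  let f : Matrix (Fin d) (Fin d) (valRing v) →ₗ[valRing v] Λ :=
    { toFun := fun A => ⟨Matrix.of fun i j => (A i j : K) * c i j, hmap A⟩
      map_add' := fun A B => by
        ext i j
        simp [add_mul]
      map_smul' := fun r A => by
        ext i j
        simp [Subring.smul_def, mul_assoc] }
  refine LinearEquiv.ofBijective f ⟨fun A B hAB => ?_, fun ⟨X, hX⟩ => ?_⟩
  · ext i j
    exact mul_right_cancel₀ (hne i j) (congrFun (congrFun (congrArg Subtype.val hAB) i) j)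
  · rw [← SetLike.mem_coe, hΛ] at hX
    have hmem (i j) : X i j / c i j ∈ valRing v := by
      change 0 ≤ v (X i j / c i j)
      have h := hX i j
      rw [← div_mul_cancel₀ (X i j) (hne i j), v.map_mul, hc] at h
      refine (WithTop.add_le_add_iff_right (WithTop.coe_ne_top (a := M i j))).1 ?_
      rwa [zero_add]
    refine ⟨Matrix.of fun i j => ⟨X i j / c i j, hmem i j⟩, ?_⟩
    ext i j
    exact div_mul_cancel₀ (X i j) (hne i j)

theorem isOrder_of_coe_eq_matSet {K : Type*} [Field K] {v : AddValuation K (WithTop ℤ)}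
    (hv : Function.Surjective v) {d : ℕ} {M : Matrix (Fin d) (Fin d) ℤ}
    (Λ : Subalgebra (valRing v) (Matrix (Fin d) (Fin d) K))
    (hΛ : (Λ : Set (Matrix (Fin d) (Fin d) K)) = matSet v M) : isOrder v Λ := by
  choose c hc using fun i j => hv (M i j)
  let e := matrixValRingEquiv Λ hΛ c hc
  refine ⟨Module.Free.of_equiv e, ?_⟩
  rw [← e.rank_eq, rank_matrix]
  simp

/-- For `M ∈ ℤ^{d×d}` with zero diagonal, `Λ_M` is an order in `K^{d×d}`
(equivalently, `Λ_M` is closed under matrix multiplication) if and only if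
`m_ij + m_jk ≥ m_ik` for all `i, j, k`. -/
theorem lam_is_order_iff_triangle {K : Type*} [Field K]
    (v : AddValuation K (WithTop ℤ)) (hv : Function.Surjective v)
    (d : ℕ) (hd : 0 < d)
    (M : Matrix (Fin d) (Fin d) ℤ) (hdiag : ∀ i, M i i = 0) :
    ((∃ Λ : Subalgebra (valRing v) (Matrix (Fin d) (Fin d) K),
        (Λ : Set (Matrix (Fin d) (Fin d) K)) = matSet v M ∧ isOrder v Λ) ↔
      ∀ i j k, M i k ≤ M i j + M j k) ∧
    ((∀ X ∈ matSet v M, ∀ Y ∈ matSet v M, X * Y ∈ matSet v M) ↔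
      ∀ i j k, M i k ≤ M i j + M j k) := by
  have hmul : (∀ X ∈ matSet v M, ∀ Y ∈ matSet v M, X * Y ∈ matSet v M) ↔
      ∀ i j k, M i k ≤ M i j + M j k :=
    ⟨triangle_of_mul_mem_matSet hv, fun hM _ hX _ hY => mul_mem_matSet hM hX hY⟩
  refine ⟨⟨?_, fun hM => ⟨matSubalgebra v M hdiag hM, rfl, isOrder_of_coe_eq_matSet hv _ rfl⟩⟩,
    hmul⟩
  rintro ⟨Λ, hΛ, -⟩
  refine hmul.1 fun X hX Y hY => ?_
  rw [← hΛ] at hX hY ⊢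
  exact Λ.mul_mem hX hY
end

section
/- Let M = (m_ij) ∈ ℤ^{d×d} satisfy m_ii = 0 for all i and m_ik ≤ m_ij + m_jk for all i, j, k. A lattice L in K^d is stable under Λ_M (i.e., XL ⊆ L for all X ∈ Λ_M) if and only if L = L_u for some u ∈ ℤ^d satisfying u_i − u_j ≤ m_ij for all 1 ≤ i, j ≤ d. -/
set_option synthInstance.maxHeartbeats 400000
set_option maxHeartbeats 1600000

open scoped Pointwise

/-- The diagonal lattice `L_u = {x ∈ K^d : val(x_i) ≥ u_i}` as a set. -/
def latSet {K : Type*} [Field K] (v : AddValuation K (WithTop ℤ)) {d : ℕ}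
    (u : Fin d → ℤ) : Set (Fin d → K) :=
  {x | ∀ i, (u i : WithTop ℤ) ≤ v (x i)}

namespace ValLattice

variable {K : Type*} [Field K] (v : AddValuation K (WithTop ℤ)) {d : ℕ}

instance isFractionRing_valRing : IsFractionRing (valRing v) K := by
  refine IsFractionRing.of_field (valRing v) K fun z => ?_
  rcases le_total 0 (v z) with h | h
  · exact ⟨⟨z, h⟩, 1, by rw [map_one, div_one]; rfl⟩
  · have hz : 0 ≤ v z⁻¹ := by
      rcases eq_or_ne z 0 with rfl | hz
      · simp
      · have h1 : v z + v z⁻¹ = 0 := by rw [← v.map_mul, mul_inv_cancel₀ hz, v.map_one]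
        calc (0 : WithTop ℤ) = v z + v z⁻¹ := h1.symm
          _ ≤ 0 + v z⁻¹ := by gcongr
          _ = v z⁻¹ := zero_add _
    exact ⟨1, ⟨z⁻¹, hz⟩, by rw [map_one, one_div]; exact (inv_inv z).symm⟩

theorem exists_le_val {S : Set K} (hS : S.Finite) : ∃ N : ℤ, ∀ s ∈ S, (N : WithTop ℤ) ≤ v s := by
  obtain ⟨b, hb⟩ := (hS.image v).bddBelow
  induction b with
  | top => exact ⟨0, fun s hs => le_top.trans (hb (Set.mem_image_of_mem v hs))⟩
  | coe N => exact ⟨N, fun s hs => hb (Set.mem_image_of_mem v hs)⟩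

variable {v} {L : Submodule (valRing v) (Fin d → K)}

theorem isLattice.finite (hL : isLattice v L) : Module.Finite (valRing v) L :=
  haveI := hL.1
  Module.finite_of_rank_eq_nat hL.2

/-- The coordinates of the vectors in a lattice have valuations bounded below. -/
theorem isLattice.exists_le_val_apply (hL : isLattice v L) (i : Fin d) :
    ∃ N : ℤ, ∀ x ∈ L, (N : WithTop ℤ) ≤ v (x i) := by
  obtain ⟨S, hS⟩ := Module.Finite.iff_fg.1 (isLattice.finite hL)
  obtain ⟨N, hN⟩ := exists_le_val v (S.finite_toSet.image fun x => x i)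
  refine ⟨N, fun x hx => ?_⟩
  rw [← hS] at hx
  induction hx using Submodule.span_induction with
  | mem x hx => exact hN _ (Set.mem_image_of_mem _ hx)
  | zero => simp
  | add x y _ _ hx hy => exact v.map_le_add hx hy
  | smul a x _ hx =>
    change (N : WithTop ℤ) ≤ v ((a : K) * x i)
    rw [v.map_mul]
    exact le_add_of_nonneg_of_le a.2 hx

/-- A lattice is not contained in a coordinate hyperplane. -/
theorem isLattice.exists_apply_ne_zero (hL : isLattice v L) (i : Fin d) :
    ∃ x ∈ L, x i ≠ 0 := by
  have := hL.1
  have := isLattice.finite hL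
  by_contra! h
  let b := Module.finBasisOfFinrankEq (valRing v) L (Module.finrank_eq_of_rank_eq hL.2)
  have hb : LinearIndependent (valRing v) fun k => (b k : Fin d → K) :=
    b.linearIndependent.map' L.subtype L.ker_subtype
  rw [LinearIndependent.iff_fractionRing (valRing v) K] at hb
  have hspan := hb.span_eq_top_of_card_eq_finrank' (by simp)
  have hle : Submodule.span K (Set.range fun k => (b k : Fin d → K)) ≤
      LinearMap.ker (LinearMap.proj i : (Fin d → K) →ₗ[K] K) := by
    rw [Submodule.span_le]
    rintro _ ⟨k, rfl⟩
    exact h _ (b k).2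
  rw [hspan] at hle
  simpa using hle (Submodule.mem_top (x := Pi.single i (1 : K)))

/-- Each coordinate attains a minimal finite valuation on a lattice. -/
theorem isLattice.exists_min_val_apply (hL : isLattice v L) (i : Fin d) :
    ∃ n : ℤ, (∃ x ∈ L, v (x i) = n) ∧ ∀ x ∈ L, (n : WithTop ℤ) ≤ v (x i) := by
  obtain ⟨N, hN⟩ := isLattice.exists_le_val_apply hL i
  obtain ⟨x, hx, hxi⟩ := isLattice.exists_apply_ne_zero hL i
  obtain ⟨m, hm⟩ := WithTop.ne_top_iff_exists.1 (v.ne_top_iff.2 hxi)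
  obtain ⟨n, ⟨y, hy, hyn⟩, hn⟩ := Int.exists_least_of_bdd
    (P := fun n : ℤ => ∃ x ∈ L, v (x i) = n)
    ⟨N, fun z ⟨y, hy, hyz⟩ => by simpa [hyz] using hN y hy⟩ ⟨m, x, hx, hm.symm⟩
  refine ⟨n, ⟨y, hy, hyn⟩, fun z hz => ?_⟩
  cases hvz : v (z i) with
  | top => exact le_top
  | coe k => exact WithTop.coe_le_coe.2 (hn k ⟨z, hz, hvz⟩)

theorem single_mem_matSet {M : Matrix (Fin d) (Fin d) ℤ} {i j : Fin d} {a : K}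
    (ha : (M i j : WithTop ℤ) ≤ v a) : Matrix.single i j a ∈ matSet v M := by
  intro k l
  by_cases h : i = k ∧ j = l
  · obtain ⟨rfl, rfl⟩ := h
    simpa using ha
  · simp [Matrix.single_apply_of_ne (h := h)]

end ValLattice

/-- For a graduated order `Λ_M`, a lattice `L` in `K^d` is stable under
`Λ_M` if and only if `L = L_u` for some `u ∈ ℤ^d` with `u_i - u_j ≤ m_ij` for all `i, j`. -/
theorem lattice_stable_iff_diagonal {K : Type*} [Field K]
    (v : AddValuation K (WithTop ℤ)) (hv : Function.Surjective v)
    (d : ℕ) (hd : 0 < d)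
    (M : Matrix (Fin d) (Fin d) ℤ) (hdiag : ∀ i, M i i = 0)
    (htri : ∀ i j k, M i k ≤ M i j + M j k)
    (L : Submodule (valRing v) (Fin d → K)) (hL : isLattice v L) :
    (∀ X ∈ matSet v M, ∀ x ∈ L, X.mulVec x ∈ L) ↔
      ∃ u : Fin d → ℤ, (∀ i j, u i - u j ≤ M i j) ∧
        (L : Set (Fin d → K)) = latSet v u := by
  constructor
  · intro hstab
    choose u hu hmin using ValLattice.isLattice.exists_min_val_apply hL
    choose x hxL hxu using hu
    have hmul {i j : Fin d} {a : K} (ha : (M i j : WithTop ℤ) ≤ v a) {y : Fin d → K}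
        (hy : y ∈ L) : Pi.single i (a * y j) ∈ L := by
      have := hstab _ (ValLattice.single_mem_matSet ha) y hy
      rwa [Matrix.single_mulVec] at this
    refine ⟨u, fun i j => ?_, Set.Subset.antisymm (fun y hy i => hmin i y hy) fun y hy => ?_⟩
    · obtain ⟨a, ha⟩ := hv (M i j)
      have := hmin i _ (hmul ha.ge (hxL j))
      rw [Pi.single_eq_same, v.map_mul, ha, hxu, ← WithTop.coe_add, WithTop.coe_le_coe] at this
      omega
    · rw [← Finset.univ_sum_single y]
      refine L.sum_mem fun i _ => ?_
      have hxi : x i i ≠ 0 := v.ne_top_iff.1 (by simp [hxu])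
      rw [← div_mul_cancel₀ (y i) hxi]
      refine hmul ?_ (hxL i)
      have h := hy i
      rw [← div_mul_cancel₀ (y i) hxi, v.map_mul, hxu] at h
      rw [hdiag]
      exact (WithTop.add_le_add_iff_right (WithTop.coe_ne_top (a := u i))).1 (by simpa using h)
  · rintro ⟨u, hu, hLu⟩ X hX x hx
    rw [← SetLike.mem_coe, hLu] at hx ⊢
    intro i
    change (u i : WithTop ℤ) ≤ v (∑ j, X i j * x j)
    refine v.map_le_sum fun j _ => ?_
    calc (u i : WithTop ℤ) ≤ (M i j : WithTop ℤ) + u j := by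
          rw [← WithTop.coe_add, WithTop.coe_le_coe]
          linarith [hu i j]
      _ ≤ v (X i j) + v (x j) := add_le_add (hX i j) (hx j)
      _ = v (X i j * x j) := (v.map_mul _ _).symm
end

section
/- Let M = (m_ij) ∈ ℝ^{d×d} have zero diagonal and satisfy m_ik ≤ m_ij + m_jk for all i, j, k, and let N = (n_ij) ∈ ℝ^{d×d} have zero diagonal with Q_N nonempty and Q_N ⊆ Q_M. Then there exists a matrix C = (c_ij) ∈ ℝ^{d×d} with zero diagonal such that c_ij ≤ m_ij for all i, j, c_ik ≤ c_ij + c_jk for all i, j, k, and Q_N = Q_C. -/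
set_option synthInstance.maxHeartbeats 400000
set_option maxHeartbeats 1600000

open scoped Pointwise

/-- The polytrope `Q_A = {u ∈ ℝ^d : u_i - u_j ≤ a_ij}`. -/
def polytrope {d : ℕ} (A : Matrix (Fin d) (Fin d) ℝ) : Set (Fin d → ℝ) :=
  {u | ∀ i j, u i - u j ≤ A i j}

/-- The tightest matrix of bounds on a set `S`: its `(i, j)` entry is the supremum of `u i - u j`
over `u ∈ S`. -/
noncomputable def supportMatrix {d : ℕ} (S : Set (Fin d → ℝ)) : Matrix (Fin d) (Fin d) ℝ :=
  fun i j => sSup ((fun u => u i - u j) '' S)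

theorem supportMatrix_le {d : ℕ} {S : Set (Fin d → ℝ)} (hS : S.Nonempty) {i j : Fin d} {b : ℝ}
    (h : ∀ u ∈ S, u i - u j ≤ b) : supportMatrix S i j ≤ b :=
  csSup_le (hS.image _) (Set.forall_mem_image.2 h)

theorem sub_le_supportMatrix {d : ℕ} {A : Matrix (Fin d) (Fin d) ℝ} {S : Set (Fin d → ℝ)}
    (hS : S ⊆ polytrope A) {u : Fin d → ℝ} (hu : u ∈ S) (i j : Fin d) :
    u i - u j ≤ supportMatrix S i j :=
  le_csSup ⟨A i j, Set.forall_mem_image.2 fun _ hv => hS hv i j⟩ (Set.mem_image_of_mem _ hu)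

/-- If `M` has zero diagonal and satisfies the triangle inequalities, and
`N` has zero diagonal with `Q_N` nonempty and `Q_N ⊆ Q_M`, then there is a matrix `C` with
zero diagonal, `C ≤ M`, satisfying the triangle inequalities, with `Q_N = Q_C`. -/
theorem subpolytrope_representation (d : ℕ)
    (M N : Matrix (Fin d) (Fin d) ℝ)
    (hMdiag : ∀ i, M i i = 0) (hMtri : ∀ i j k, M i k ≤ M i j + M j k)
    (hNdiag : ∀ i, N i i = 0)
    (hne : (polytrope N).Nonempty) (hsub : polytrope N ⊆ polytrope M) :
    ∃ C : Matrix (Fin d) (Fin d) ℝ,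
      (∀ i, C i i = 0) ∧ (∀ i j, C i j ≤ M i j) ∧
      (∀ i j k, C i k ≤ C i j + C j k) ∧ polytrope N = polytrope C := by
  have hle := @sub_le_supportMatrix d N (polytrope N) subset_rfl
  refine ⟨supportMatrix (polytrope N), fun i => ?_, fun i j => ?_, fun i j k => ?_, ?_⟩
  · obtain ⟨u, hu⟩ := hne
    refine le_antisymm (supportMatrix_le ⟨u, hu⟩ fun v _ => (sub_self _).le) ?_
    simpa using hle hu i i
  · exact supportMatrix_le hne fun u hu => hsub hu i j
  · refine supportMatrix_le hne fun u hu => ?_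
    linarith [hle hu i j, hle hu j k]
  · refine Set.Subset.antisymm (fun u hu => hle hu) fun u hu i j => ?_
    exact (hu i j).trans (supportMatrix_le hne fun v hv => hv i j)
end

section
/- Let σ be a permutation of {1,…,d} and u ∈ ℤ^d. For i = 1,…,d let w^(i) ∈ ℤ^d be the vector with first i−1 coordinates equal to 1 and the rest 0, let h_σ ∈ GL_d(K) be the permutation matrix with h_σ e_j = e_{σ(j)}, let g_u = diag(p^{u_1},…,p^{u_d}), and let M_0 ∈ ℤ^{d×d} have (M_0)_{ij} = 1 if i < j and (M_0)_{ij} = 0 otherwise. Then the intersection of the 2d endomorphism rings (⋂_{i=1}^d End_{O_K}(L_{w^(i)})) ∩ (⋂_{i=1}^d End_{O_K}(h_σ g_u · L_{w^(i)})) equals Λ_M, where m_ij = max( (M_0)_{ij}, u_{σ^{-1}(i)} + (M_0)_{σ^{-1}(i),σ^{-1}(j)} − u_{σ^{-1}(j)} ) for all 1 ≤ i, j ≤ d. -/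
set_option synthInstance.maxHeartbeats 400000
set_option maxHeartbeats 1600000

open scoped Pointwise

theorem WithTop.coe_int_sub_le_iff (a b : ℤ) (x : WithTop ℤ) :
    ((a - b : ℤ) : WithTop ℤ) ≤ x ↔ (a : WithTop ℤ) ≤ x + b := by
  induction x using WithTop.recTopCoe with
  | top => simp
  | coe x =>
    rw [← WithTop.coe_add, WithTop.coe_le_coe, WithTop.coe_le_coe]
    omega

theorem AddValuation.map_zpow_of_eq_one {K : Type*} [Field K] (v : AddValuation K (WithTop ℤ))
    {p : K} (hp : v p = (1 : WithTop ℤ)) (n : ℤ) : v (p ^ n) = (n : WithTop ℤ) := by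
  have hnat (m : ℕ) : v (p ^ m) = ((m : ℤ) : WithTop ℤ) := by
    induction m with
    | zero => simp
    | succ m ih =>
      rw [pow_succ, v.map_mul, ih, hp]
      rfl
  have hp0 : p ≠ 0 := by
    rintro rfl
    rw [v.map_zero] at hp
    exact WithTop.top_ne_one hp
  obtain ⟨m, rfl | rfl⟩ := n.eq_nat_or_neg
  · rw [zpow_natCast, hnat]
  · have h : v (p ^ (-(m : ℤ))) + ((m : ℤ) : WithTop ℤ) = 0 := by
      rw [← hnat, ← v.map_mul, ← zpow_natCast, ← zpow_add₀ hp0]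
      simp
    generalize v (p ^ (-(m : ℤ))) = x at h
    induction x using WithTop.recTopCoe with
    | top => simp at h
    | coe x =>
      rw [← WithTop.coe_add, ← WithTop.coe_zero, WithTop.coe_inj] at h
      rw [WithTop.coe_inj]
      omega

/-- The endomorphism ring of a diagonal lattice is cut out by entrywise valuation bounds. -/
theorem mem_endSet_latSet_iff {K : Type*} [Field K] (v : AddValuation K (WithTop ℤ))
    {p : K} (hp : v p = (1 : WithTop ℤ)) {d : ℕ} (u : Fin d → ℤ)
    (X : Matrix (Fin d) (Fin d) K) :
    X ∈ endSet (latSet v u) ↔ ∀ i j, ((u i - u j : ℤ) : WithTop ℤ) ≤ v (X i j) := by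
  refine ⟨fun h i j => ?_, fun h x hx i => ?_⟩
  · have hmem : Pi.single j (p ^ u j) ∈ latSet v u := fun k => by
      by_cases hk : k = j
      · subst hk
        simp [v.map_zpow_of_eq_one hp]
      · simp [Pi.single_eq_of_ne hk]
    have := h _ hmem i
    rw [Matrix.mulVec_single] at this
    rw [WithTop.coe_int_sub_le_iff]
    simpa [v.map_zpow_of_eq_one hp] using this
  · rw [Matrix.mulVec, dotProduct]
    refine v.map_le_sum fun j _ => ?_
    rw [v.map_mul]
    exact ((WithTop.coe_int_sub_le_iff _ _ _).1 (h i j)).trans (add_le_add le_rfl (hx j))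

/-- A monomial matrix maps diagonal lattices to diagonal lattices. -/
theorem image_monomial_latSet {K : Type*} [Field K] (v : AddValuation K (WithTop ℤ))
    {p : K} (hp : v p = (1 : WithTop ℤ)) {d : ℕ} (σ : Equiv.Perm (Fin d)) (u w : Fin d → ℤ)
    (P : Matrix (Fin d) (Fin d) K) (hP : ∀ i j, P i j = if i = σ j then 1 else 0) :
    (fun x => (P * Matrix.diagonal fun i => p ^ u i).mulVec x) '' latSet v w =
      latSet v fun i => u (σ.symm i) + w (σ.symm i) := by
  have hp0 : p ≠ 0 := by
    rintro rfl
    rw [v.map_zero] at hp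
    exact WithTop.top_ne_one hp
  have happ (x : Fin d → K) (i : Fin d) :
      (P * Matrix.diagonal fun i => p ^ u i).mulVec x i =
        p ^ u (σ.symm i) * x (σ.symm i) := by
    simp only [Matrix.mulVec, dotProduct, Matrix.mul_diagonal, hP, ← Equiv.symm_apply_eq]
    simp
  ext y
  constructor
  · rintro ⟨x, hx, rfl⟩ i
    simp only [happ, v.map_mul, v.map_zpow_of_eq_one hp, WithTop.coe_add]
    exact add_le_add le_rfl (hx _)
  · intro hy
    refine ⟨fun j => p ^ (-u j) * y (σ j), fun j => ?_, ?_⟩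
    · have h := hy (σ j)
      simp only [Equiv.symm_apply_apply] at h
      rw [v.map_mul, v.map_zpow_of_eq_one hp, add_comm, ← WithTop.coe_int_sub_le_iff]
      simpa [add_comm] using h
    · ext i
      simp [happ, ← mul_assoc, mul_inv_cancel₀ (zpow_ne_zero _ hp0)]

/-- Let `σ` be a permutation of `{1,…,d}` and `u ∈ ℤ^d`. With
`w⁽ⁱ⁾` the 0/1-vectors of the standard chamber, `h_σ` the permutation matrix, `g_u` the
diagonal matrix `diag(p^{u_1},…,p^{u_d})` and `M₀` the strict-upper-triangular 0/1 matrix,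
the Plesken–Zassenhaus order of the two chambers `C₀` and `h_σ g_u C₀` equals `Λ_M` where
`m_ij = max((M₀)_ij, u_{σ⁻¹(i)} + (M₀)_{σ⁻¹(i)σ⁻¹(j)} - u_{σ⁻¹(j)})`. -/
theorem pz_order_of_two_chambers {K : Type*} [Field K]
    (v : AddValuation K (WithTop ℤ)) (hv : Function.Surjective v)
    (p : K) (hp : v p = (1 : WithTop ℤ))
    (d : ℕ) (hd : 0 < d)
    (σ : Equiv.Perm (Fin d)) (u : Fin d → ℤ)
    (w : Fin d → Fin d → ℤ)
    (hw : ∀ i j, w i j = if (j : ℕ) < (i : ℕ) then 1 else 0)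
    (M₀ : Matrix (Fin d) (Fin d) ℤ)
    (hM₀ : ∀ i j, M₀ i j = if (i : ℕ) < (j : ℕ) then 1 else 0)
    (hσ : Matrix (Fin d) (Fin d) K)
    (hσdef : ∀ i j, hσ i j = if i = σ j then 1 else 0)
    (gᵤ : Matrix (Fin d) (Fin d) K)
    (hgᵤ : gᵤ = Matrix.diagonal fun i => p ^ (u i))
    (M : Matrix (Fin d) (Fin d) ℤ)
    (hM : ∀ i j, M i j =
      max (M₀ i j) (u (σ.symm i) + M₀ (σ.symm i) (σ.symm j) - u (σ.symm j))) :
    ((⋂ i : Fin d, endSet (latSet v (w i))) ∩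
        ⋂ i : Fin d, endSet ((fun x => (hσ * gᵤ).mulVec x) '' latSet v (w i)))
      = matSet v M := by
  subst hgᵤ
  ext X
  simp only [image_monomial_latSet v hp σ u _ hσ hσdef, Set.mem_inter_iff, Set.mem_iInter,
    mem_endSet_latSet_iff v hp]
  have hsub (k i j : Fin d) : w k i - w k j ≤ M₀ i j := by
    rw [hw, hw, hM₀]
    split_ifs <;> omega
  have hattained (i j : Fin d) : ∃ k, w k i - w k j = M₀ i j := by
    by_cases hij : (i : ℕ) < j
    · exact ⟨j, by simp [hw, hM₀, hij]⟩
    · exact ⟨⟨0, hd⟩, by simp [hw, hM₀, hij]⟩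
  constructor
  · rintro ⟨h₁, h₂⟩ i j
    rw [hM, WithTop.coe_max, max_le_iff]
    constructor
    · obtain ⟨k, hk⟩ := hattained i j
      exact hk ▸ h₁ k i j
    · obtain ⟨k, hk⟩ := hattained (σ.symm i) (σ.symm j)
      refine le_trans (WithTop.coe_le_coe.2 ?_) (h₂ k i j)
      omega
  · refine fun h => ⟨fun k i j => ?_, fun k i j => ?_⟩ <;>
      refine le_trans (WithTop.coe_le_coe.2 ?_) (h i j) <;> rw [hM]
    · exact le_max_of_le_left (hsub k i j)
    · refine le_max_of_le_right ?_
      linarith [hsub k (σ.symm i) (σ.symm j)]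
end
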